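/- Let k be a field, let f(x) = f_n x^n + … + f_1 x + f_0 ∈ k[x] be a separable polynomial of degree n with f_n ≠ 0, let L = k[x]/(f) = k[θ], and fix a unit ξ ∈ L^×. Define quadratic forms Q_0, …, Q_{n−1} ∈ k[u_0,…,u_{n−1}] by ξ(u_0 + u_1θ + … + u_{n−1}θ^{n−1})² = Σ_{j=0}^{n−1} Q_j θ^j, and let 𝐆 be the n×n matrix with (i,j) entry Tr_{L/k}(f_n ξ θ^{i+j}/f'(θ)). Let J ∈ k[u_0,…,u_{n−1}] be the Jacobian determinant det(∂Q_i/∂u_j). Then J² = 4^n (−1)^{n(n−1)/2} det(𝐆) · N(Σ_{j=0}^{n−1} Q_j θ^j), where N denotes the norm from L[u_0,…,u_{n−1}] to k[u_0,…,u_{n−1}] (the determinant of multiplication with respect to the basis 1, θ, …, θ^{n−1}). -/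

import Mathlib

open Polynomial Matrix

/-- The roots of a separable polynomial, enumerated in an algebraic closure. -/
lemma aux_roots (k : Type*) [Field k] (n : ℕ) (f : k[X])
    (hdeg : f.degree = n) (hsep : f.Separable) :
    ∃ r : Fin n → AlgebraicClosure k, Function.Injective r ∧
      f.map (algebraMap k (AlgebraicClosure k)) =
        C (algebraMap k (AlgebraicClosure k) f.leadingCoeff) * Lagrange.nodal Finset.univ r := by
  classical
  set g := f.map (algebraMap k (AlgebraicClosure k)) with hg
  have hs : g.Splits := IsAlgClosed.splits g
  have hnd : g.roots.Nodup := nodup_roots (hsep.map)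
  have hcard : g.roots.toFinset.card = n := by
    rw [Multiset.toFinset_card_of_nodup hnd, ← hs.natDegree_eq_card_roots, hg, natDegree_map]
    exact natDegree_eq_of_degree_eq_some hdeg
  let e := (g.roots.toFinset.equivFinOfCardEq hcard).symm
  refine ⟨fun a => (e a : AlgebraicClosure k), ?_, ?_⟩
  · exact Subtype.val_injective.comp e.injective
  · have h1 := hs.eq_prod_roots
    refine h1.trans ?_
    congr 1
    · rw [hg, leadingCoeff_map]
    · rw [Lagrange.nodal, e.prod_comp (fun x => (X - C (x : AlgebraicClosure k))),
        Finset.prod_coe_sort g.roots.toFinset (fun x => (X - C (x : AlgebraicClosure k))),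
        Finset.prod, Multiset.toFinset_val, hnd.dedup]

lemma aux_det {R : Type*} [CommRing R] [IsDomain R] {n : ℕ} (V M : Matrix (Fin n) (Fin n) R)
    (D : Fin n → R) (hV : V.det ≠ 0) (h : V * M = Matrix.diagonal D * V) :
    M.det = ∏ a, D a := by
  have := congrArg Matrix.det h
  rw [det_mul, det_mul, det_diagonal, mul_comm] at this
  exact mul_right_cancel₀ hV this

lemma aux_trace {R : Type*} [Field R] {n : ℕ} (V M : Matrix (Fin n) (Fin n) R)
    (D : Fin n → R) (hV : V.det ≠ 0) (h : V * M = Matrix.diagonal D * V) :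
    M.trace = ∑ a, D a := by
  have hu : IsUnit V.det := isUnit_iff_ne_zero.2 hV
  have : M = V⁻¹ * (Matrix.diagonal D * V) := by
    rw [← h, ← Matrix.mul_assoc, Matrix.nonsing_inv_mul _ hu, Matrix.one_mul]
  rw [this, Matrix.trace_mul_comm, Matrix.mul_assoc, Matrix.mul_nonsing_inv _ hu, Matrix.mul_one,
    Matrix.trace_diagonal]

lemma aux_sign {K : Type*} [Field K] {n : ℕ} (r : Fin n → K) :
    ∏ a, ∏ b ∈ Finset.univ.erase a, (r a - r b) =
      (-1) ^ (n * (n - 1) / 2) * (Matrix.vandermonde r).det ^ 2 := by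
  have h := Finset.prod_prod_Ioi_mul_eq_prod_prod_off_diag (fun i j => r j - r i)
  have h2 : ∀ a : Fin n, Finset.univ.erase a = {a}ᶜ := by
    intro a; ext; simp
  simp_rw [h2]
  rw [← h, det_vandermonde, ← Finset.prod_pow]
  have h3 : ∀ i j : Fin n, (r i - r j) * (r j - r i) = (-1) * (r j - r i) ^ 2 := by
    intros; ring
  simp_rw [h3, Finset.prod_mul_distrib, Finset.prod_pow]
  congr 1
  simp only [Finset.prod_const, Fin.card_Ioi]
  rw [Finset.prod_pow_eq_pow_sum, Fin.sum_univ_eq_sum_range (fun i => n - 1 - i) n,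
    Finset.sum_range_reflect (fun i => i) n, Finset.sum_range_id]

lemma aux_tr (k : Type*) [Field k] (n : ℕ) (f : k[X])
    (hdeg : f.degree = n) (K : Type*) [Field K] [Algebra k K] (r : Fin n → K)
    (hr : Function.Injective r) (φ : Fin n → (AdjoinRoot f →ₐ[k] K))
    (hφ : ∀ a, φ a (AdjoinRoot.root f) = r a) (z : AdjoinRoot f) :
    algebraMap k K (Algebra.trace k (AdjoinRoot f) z) = ∑ a, φ a z := by
  have hn : f.natDegree = n := natDegree_eq_of_degree_eq_some hdeg
  have hf : f ≠ 0 := by rintro rfl; simp at hdeg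
  let B : Module.Basis (Fin n) k (AdjoinRoot f) :=
    (AdjoinRoot.powerBasis hf).basis.reindex (finCongr hn)
  have hB : ∀ i, B i = AdjoinRoot.root f ^ (i : ℕ) := fun i => by
    simp [B]
    rfl
  rw [Algebra.trace_eq_matrix_trace B, ← RingHom.coe_coe, AddMonoidHom.map_trace]
  refine aux_trace (Matrix.vandermonde r) _ _ (det_vandermonde_ne_zero_iff.2 hr) ?_
  ext a j
  rw [Matrix.diagonal_mul, Matrix.mul_apply]
  have h := congrArg (φ a) (B.sum_repr (z * B j))
  simp only [map_sum, map_smul, map_mul, hB, map_pow, hφ] at h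
  simp only [vandermonde_apply, Matrix.map_apply]
  rw [← h]
  refine Finset.sum_congr rfl fun i _ => ?_
  rw [Algebra.leftMulMatrix_eq_repr_mul, Algebra.smul_def, mul_comm, hB]
  rfl


/-- Proposition 2.5(iv): the Jacobian determinant `J = det(∂Q_i/∂u_j)` satisfies
`J² = 4^n (−1)^{n(n−1)/2} det(𝐆) · N(Σ Q_j θ^j)`, where `N` is the norm from
`L[u₀,…,u_{n−1}]` to `k[u₀,…,u_{n−1}]`, computed as the determinant of the
multiplication matrix with respect to the basis `1, θ, …, θ^{n−1}`. -/
theorem stmt_3 (k : Type*) [Field k] (n : ℕ) (f : k[X])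
    (hdeg : f.degree = n) (hsep : f.Separable)
    (ξ : (AdjoinRoot f)ˣ) (d : AdjoinRoot f)
    (hd : aeval (AdjoinRoot.root f) (derivative f) * d = 1)
    (Q : Fin n → MvPolynomial (Fin n) k)
    (hQ : MvPolynomial.C (ξ : AdjoinRoot f) *
        (∑ i : Fin n, MvPolynomial.C (AdjoinRoot.root f ^ (i : ℕ)) * MvPolynomial.X i) ^ 2
      = ∑ j : Fin n, MvPolynomial.map (algebraMap k (AdjoinRoot f)) (Q j)
          * MvPolynomial.C (AdjoinRoot.root f ^ (j : ℕ)))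
    (G : Matrix (Fin n) (Fin n) k)
    (hG : ∀ i j : Fin n, G i j =
      Algebra.trace k (AdjoinRoot f)
        (f.leadingCoeff • ((ξ : AdjoinRoot f) * AdjoinRoot.root f ^ ((i : ℕ) + (j : ℕ)) * d)))
    (J : MvPolynomial (Fin n) k)
    (hJ : J = Matrix.det (Matrix.of fun i j : Fin n => MvPolynomial.pderiv j (Q i)))
    (N : Matrix (Fin n) (Fin n) (MvPolynomial (Fin n) k))
    (hN : ∀ j : Fin n,
      (∑ j' : Fin n, MvPolynomial.map (algebraMap k (AdjoinRoot f)) (Q j')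
          * MvPolynomial.C (AdjoinRoot.root f ^ ((j' : ℕ))))
          * MvPolynomial.C (AdjoinRoot.root f ^ (j : ℕ))
        = ∑ i : Fin n, MvPolynomial.map (algebraMap k (AdjoinRoot f)) (N i j)
            * MvPolynomial.C (AdjoinRoot.root f ^ (i : ℕ))) :
    J ^ 2 = 4 ^ n * (-1) ^ (n * (n - 1) / 2) * MvPolynomial.C G.det * N.det := by

  classical
  obtain ⟨r, hr, hfr⟩ := aux_roots k n f hdeg hsep
  have hf : f ≠ 0 := by rintro rfl; simp at hdeg
  have hlc : algebraMap k (AlgebraicClosure k) f.leadingCoeff ≠ 0 := by simpa using hf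
  have hroot : ∀ a, f.eval₂ (Algebra.ofId k (AlgebraicClosure k)) (r a) = 0 := by
    intro a
    have : (f.map (algebraMap k (AlgebraicClosure k))).eval (r a) = 0 := by
      rw [hfr, eval_mul, Lagrange.eval_nodal_at_node (Finset.mem_univ a), mul_zero]
    rwa [eval_map] at this
  let φ : Fin n → (AdjoinRoot f →ₐ[k] (AlgebraicClosure k)) := fun a =>
    AdjoinRoot.liftAlgHom f (Algebra.ofId k (AlgebraicClosure k)) (r a) (hroot a)
  have hφ : ∀ a, φ a (AdjoinRoot.root f) = r a := fun a => AdjoinRoot.liftAlgHom_root _ _ _ _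
  -- derivative at roots
  have hder : ∀ a, (algebraMap k (AlgebraicClosure k) f.leadingCoeff * ∏ b ∈ Finset.univ.erase a, (r a - r b))
      * φ a d = 1 := by
    intro a
    have h := congrArg (φ a) hd
    rw [map_mul, map_one, ← aeval_algHom_apply, hφ, aeval_def, ← eval_map, ← derivative_map, hfr,
      derivative_C_mul, eval_mul, eval_C,
      Lagrange.eval_nodal_derivative_eval_node_eq (Finset.mem_univ a), Lagrange.eval_nodal] at h
    exact h
  -- det of G
  have hVK : (Matrix.vandermonde r).det ≠ 0 := det_vandermonde_ne_zero_iff.2 hr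
  have hGdet : (-1) ^ (n * (n - 1) / 2) * algebraMap k (AlgebraicClosure k) G.det = ∏ a, φ a ξ := by
    have hGm : G.map (algebraMap k (AlgebraicClosure k)) = (Matrix.vandermonde r)ᵀ *
        (Matrix.diagonal (fun a => algebraMap k (AlgebraicClosure k) f.leadingCoeff * φ a ξ * φ a d)
          * Matrix.vandermonde r) := by
      ext i j
      rw [Matrix.map_apply, hG, aux_tr k n f hdeg (AlgebraicClosure k) r hr φ hφ, Matrix.mul_apply]
      refine Finset.sum_congr rfl fun a _ => ?_
      rw [Matrix.diagonal_mul, Matrix.transpose_apply, vandermonde_apply, vandermonde_apply,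
        map_smul, Algebra.smul_def, map_mul, map_mul, map_pow, hφ]
      ring
    have h1 : algebraMap k (AlgebraicClosure k) G.det = (Matrix.vandermonde r).det ^ 2 *
        ∏ a, (algebraMap k (AlgebraicClosure k) f.leadingCoeff * φ a ξ * φ a d) := by
      rw [RingHom.map_det, RingHom.mapMatrix_apply, hGm, det_mul, det_mul, det_transpose,
        det_diagonal]
      ring
    rw [h1, ← mul_assoc, ← aux_sign, ← Finset.prod_mul_distrib]
    refine Finset.prod_congr rfl fun a _ => ?_
    linear_combination (φ a ξ) * hder a
  -- polynomial ring
  let ι : MvPolynomial (Fin n) k →+* MvPolynomial (Fin n) (AlgebraicClosure k) := MvPolynomial.map (algebraMap k (AlgebraicClosure k))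
  have hι : Function.Injective ι := MvPolynomial.map_injective _ (algebraMap k (AlgebraicClosure k)).injective
  let V : Matrix (Fin n) (Fin n) (MvPolynomial (Fin n) (AlgebraicClosure k)) :=
    (Matrix.vandermonde r).map MvPolynomial.C
  have hV : V.det ≠ 0 := by
    have : V.det = MvPolynomial.C (Matrix.vandermonde r).det := by
      rw [RingHom.map_det, RingHom.mapMatrix_apply]
    rw [this]
    simpa using hVK
  let l : Fin n → MvPolynomial (Fin n) (AlgebraicClosure k) := fun a =>
    ∑ i : Fin n, MvPolynomial.C (r a ^ (i : ℕ)) * MvPolynomial.X i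
  have hcomp : ∀ (a : Fin n) (p : MvPolynomial (Fin n) k),
      MvPolynomial.map (φ a : AdjoinRoot f →+* (AlgebraicClosure k))
        (MvPolynomial.map (algebraMap k (AdjoinRoot f)) p) = ι p := by
    intro a p
    rw [MvPolynomial.map_map, AlgHom.comp_algebraMap]
  have hQa : ∀ a, MvPolynomial.C (φ a ξ) * l a ^ 2 =
      ∑ j : Fin n, ι (Q j) * MvPolynomial.C (r a ^ (j : ℕ)) := by
    intro a
    have h := congrArg (MvPolynomial.map (φ a : AdjoinRoot f →+* (AlgebraicClosure k))) hQ
    simp only [map_sum, map_mul, map_pow, hcomp, MvPolynomial.map_C, MvPolynomial.map_X,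
      RingHom.coe_coe, hφ] at h
    simpa only [l, map_pow] using h
  have hJι : ι J = ∏ a, (2 * MvPolynomial.C (φ a ξ) * l a) := by
    rw [hJ, RingHom.map_det, RingHom.mapMatrix_apply]
    refine aux_det V _ _ hV ?_
    ext1 a m
    have h := congrArg (MvPolynomial.pderiv m) (hQa a)
    have hl : MvPolynomial.pderiv m (l a) = MvPolynomial.C (r a ^ (m : ℕ)) := by
      simp only [l, map_sum, MvPolynomial.pderiv_C_mul, MvPolynomial.pderiv_X, Pi.single_apply,
        mul_ite, mul_one, mul_zero]
      simp
    rw [MvPolynomial.pderiv_C_mul, MvPolynomial.pderiv_pow, hl, map_sum] at h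
    rw [Matrix.diagonal_mul, Matrix.mul_apply]
    simp only [V, Matrix.map_apply, vandermonde_apply, Matrix.of_apply]
    have h2 : ∀ j, MvPolynomial.pderiv m (ι (Q j) * MvPolynomial.C (r a ^ (j : ℕ))) =
        MvPolynomial.C (r a ^ (j : ℕ)) * ι (MvPolynomial.pderiv m (Q j)) := by
      intro j
      rw [mul_comm, MvPolynomial.pderiv_C_mul, MvPolynomial.pderiv_map]
    simp_rw [h2] at h
    rw [← h]
    push_cast
    ring
  have hNι : ι N.det = ∏ a, (MvPolynomial.C (φ a ξ) * l a ^ 2) := by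
    rw [RingHom.map_det, RingHom.mapMatrix_apply]
    refine aux_det V _ _ hV ?_
    ext1 a j
    have h := congrArg (MvPolynomial.map (φ a : AdjoinRoot f →+* (AlgebraicClosure k))) (hN j)
    rw [← hQ] at h
    simp only [map_sum, map_mul, map_pow, hcomp, MvPolynomial.map_C, MvPolynomial.map_X,
      RingHom.coe_coe, hφ] at h
    rw [Matrix.diagonal_mul, Matrix.mul_apply]
    simp only [V, l, Matrix.map_apply, vandermonde_apply, map_pow]
    rw [h]
    exact Finset.sum_congr rfl fun i _ => mul_comm _ _
  apply hι
  have hC : ι (MvPolynomial.C G.det) = MvPolynomial.C (algebraMap k (AlgebraicClosure k) G.det) :=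
    MvPolynomial.map_C _ _
  have hs : (-1) ^ (n * (n - 1) / 2) * MvPolynomial.C (algebraMap k (AlgebraicClosure k) G.det) =
      (∏ a, MvPolynomial.C (φ a ξ) : MvPolynomial (Fin n) (AlgebraicClosure k)) := by
    rw [← map_prod, ← hGdet]; simp
  simp only [map_mul, map_pow, map_neg, map_one, hC, map_ofNat]
  rw [mul_assoc (4 ^ n), hs, hJι, hNι]
  simp only [Finset.prod_mul_distrib, Finset.prod_pow, Finset.prod_const, Finset.card_univ,
    Fintype.card_fin]
  rw [show (4 : MvPolynomial (Fin n) (AlgebraicClosure k)) = 2 ^ 2 by norm_num, ← pow_mul, mul_comm 2 n, pow_mul]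
  ring
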